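/- Let d, r ∈ ℕ, let I₁, I₂ be r-dimensional registers, I₃ a 2-dimensional register and F a flag, all pairwise disjoint, and let enc_Δ : {L, S, R} → {−1,1}² be an injective map on a three-element set {L, S, R}. Then there exists an MLP f with input dimension d, hidden dimension 6r and ternary weights such that for all x ∈ {−1,0,1}^d with x[I₁] = bin_r(s) for some integer s ∈ {0,1,…,2^r − 2} and x[F] = 1: f(x)[I₂] = bin_r(max(0, s − 1)) if x[I₃] = enc_Δ(L), f(x)[I₂] = bin_r(s + 1) if x[I₃] = enc_Δ(R), and f(x)[I₂] = bin_r(s) if x[I₃] = enc_Δ(S); moreover f(x)[I₂] = 0 whenever x ∈ {−1,0,1}^d with x[F] = 0, and all coordinates of f(x) at indices not in I₂ are always 0. -/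

import Mathlib

/-- A single-hidden-layer ReLU MLP `x ↦ W₂ ReLU(W₁ x + b)` with input/output dimension `d`
and hidden dimension `dff`. -/
structure MLP (d dff : ℕ) where
  W1 : Matrix (Fin dff) (Fin d) ℝ
  b : Fin dff → ℝ
  W2 : Matrix (Fin d) (Fin dff) ℝ

/-- The hidden activations `ReLU(W₁ x + b)` of the MLP. -/
noncomputable def MLP.hidden {d dff : ℕ} (f : MLP d dff) (x : Fin d → ℝ) : Fin dff → ℝ :=
  fun h => max 0 (f.W1.mulVec x h + f.b h)

/-- The output `W₂ ReLU(W₁ x + b)` of the MLP. -/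
noncomputable def MLP.eval {d dff : ℕ} (f : MLP d dff) (x : Fin d → ℝ) : Fin d → ℝ :=
  f.W2.mulVec (f.hidden x)

/-- The MLP has ternary weights: all entries of `W₁` and `W₂` lie in `{-1,0,1}`. -/
def MLP.Ternary {d dff : ℕ} (f : MLP d dff) : Prop :=
  (∀ i j, f.W1 i j = -1 ∨ f.W1 i j = 0 ∨ f.W1 i j = 1) ∧
  (∀ i j, f.W2 i j = -1 ∨ f.W2 i j = 0 ∨ f.W2 i j = 1)

def IsTernary (a : ℝ) : Prop := a = -1 ∨ a = 0 ∨ a = 1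
def IsBit (a : ℝ) : Prop := a = 0 ∨ a = 1
def IsSign (a : ℝ) : Prop := a = -1 ∨ a = 1

/-- The ±1 binary representation of `i` with `r` bits, least significant bit first:
bit `s` is `1` if `⌊i / 2^s⌋` is odd and `-1` otherwise. -/
def binRep (r : ℕ) (i : ℕ) : Fin r → ℝ :=
  fun s => if (i / 2 ^ (s : ℕ)) % 2 = 1 then 1 else -1

/-- The three head movements of a Turing machine: left, stay, right. -/
inductive Move : Type
  | L : Move
  | S : Move
  | R : Move

theorem IsTernary.abs_le_one {a : ℝ} (h : IsTernary a) : |a| ≤ 1 := by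
  rcases h with h | h | h <;> simp [h]

theorem IsSign.isTernary {a : ℝ} (h : IsSign a) : IsTernary a := by
  rcases h with h | h <;> simp [IsTernary, h]

theorem isTernary_zero : IsTernary 0 := Or.inr (Or.inl rfl)

theorem isTernary_one : IsTernary 1 := Or.inr (Or.inr rfl)

theorem IsTernary.neg {a : ℝ} (h : IsTernary a) : IsTernary (-a) := by
  rcases h with h | h | h <;> simp [IsTernary, h]

theorem IsTernary.ite {a b : ℝ} {P : Prop} [Decidable P] (ha : IsTernary a) (hb : IsTernary b) :
    IsTernary (if P then a else b) := by
  split_ifs <;> assumption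

theorem IsTernary.extend {α β : Type*} (J : α → β) {w : α → ℝ} (hw : ∀ a, IsTernary (w a))
    (i : β) : IsTernary (Function.extend J w 0 i) := by
  classical
  rw [Function.extend_def]
  split_ifs
  · exact hw _
  · exact isTernary_zero

theorem sum_extend_mul {α β : Type*} [Fintype α] [Fintype β] {J : α → β}
    (hJ : Function.Injective J) (w : α → ℝ) (x : β → ℝ) :
    ∑ i, Function.extend J w 0 i * x i = ∑ a, w a * x (J a) := by
  symm
  apply Fintype.sum_of_injective J hJ
  · intro i hi
    rw [Function.extend_apply' _ _ _ (by simpa using hi)]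
    simp
  · intro a
    rw [hJ.extend_apply]

section Conjunction

variable {ι : Type*} [Fintype ι]

/-- A neuron, gated by `flag`, that tests whether `y` agrees with `w` on the support of `w`. -/
noncomputable def conjNeuron (w y : ι → ℝ) (flag : ℝ) : ℝ :=
  max 0 (∑ a, w a * y a + flag - ∑ a, |w a|)

theorem mul_le_abs_of_isTernary (w : ℝ) {y : ℝ} (hy : IsTernary y) : w * y ≤ |w| :=
  calc w * y ≤ |w| * |y| := by rw [← abs_mul]; exact le_abs_self _
    _ ≤ |w| := mul_le_of_le_one_right (abs_nonneg _) hy.abs_le_one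

theorem conjNeuron_zero (w : ι → ℝ) {y : ι → ℝ} (hy : ∀ a, IsTernary (y a)) :
    conjNeuron w y 0 = 0 := by
  have h : ∑ a, w a * y a ≤ ∑ a, |w a| :=
    Finset.sum_le_sum fun a _ => mul_le_abs_of_isTernary _ (hy a)
  exact max_eq_left (by linarith)

theorem conjNeuron_one_of_match {w y : ι → ℝ} (hw : ∀ a, IsTernary (w a))
    (h : ∀ a, w a ≠ 0 → y a = w a) : conjNeuron w y 1 = 1 := by
  have h' : ∑ a, w a * y a = ∑ a, |w a| := by
    refine Finset.sum_congr rfl fun a _ => ?_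
    rcases hw a with h1 | h1 | h1
    · simp [h a (by simp [h1]), h1]
    · simp [h1]
    · simp [h a (by simp [h1]), h1]
  simp [conjNeuron, h']

theorem conjNeuron_one_of_mismatch {w y : ι → ℝ} (hw : ∀ a, IsTernary (w a))
    (hy : ∀ a, IsSign (y a)) {a : ι} (ha : w a ≠ 0) (h : y a ≠ w a) :
    conjNeuron w y 1 = 0 := by
  classical
  have h1 : ∑ b ∈ Finset.univ.erase a, w b * y b ≤ ∑ b ∈ Finset.univ.erase a, |w b| :=
    Finset.sum_le_sum fun b _ => mul_le_abs_of_isTernary _ (hy b).isTernary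
  have h2 : w a * y a ≤ |w a| - 1 := by
    rcases hw a with h3 | h3 | h3 <;> rcases hy a with h4 | h4 <;> simp_all
  have h5 := Finset.add_sum_erase _ (fun b => |w b|) (Finset.mem_univ a)
  have h6 := Finset.add_sum_erase _ (fun b => w b * y b) (Finset.mem_univ a)
  exact max_eq_left (by linarith)

end Conjunction

section Binary

theorem binRep_eq_testBit (r i : ℕ) (t : Fin r) :
    binRep r i t = if i.testBit t then 1 else -1 := by
  simp [binRep, Nat.testBit_eq_decide_div_mod_eq]

theorem binRep_isSign (r i : ℕ) (t : Fin r) : IsSign (binRep r i t) := by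
  unfold binRep IsSign
  split_ifs <;> simp

theorem binRep_zero (r : ℕ) (t : Fin r) : binRep r 0 t = -1 := by
  simp [binRep]

/-- The binary representations of `a` and `a + 1` differ exactly up to the lowest zero bit
of `a`. -/
theorem exists_binRep_succ (r a : ℕ) (ha : a + 1 < 2 ^ r) :
    ∃ k : Fin r, (∀ j < k, binRep r a j = 1 ∧ binRep r (a + 1) j = -1) ∧
      (binRep r a k = -1 ∧ binRep r (a + 1) k = 1) ∧
      ∀ j, k < j → binRep r (a + 1) j = binRep r a j := by
  obtain ⟨k, m, ⟨q, rfl⟩, h⟩ := Nat.exists_eq_two_pow_mul_odd (Nat.succ_ne_zero a)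
  have hpos : 0 < 2 ^ k := by positivity
  have h1 : a + 1 = 2 ^ k * (2 * q + 1) + 0 := h
  have h0 : a = 2 ^ k * (2 * q) + (2 ^ k - 1) := by
    have : 2 ^ k * (2 * q + 1) = 2 ^ k * (2 * q) + 2 ^ k := by ring
    omega
  have hk : k < r := by
    refine (Nat.pow_lt_pow_iff_right (a := 2) (by norm_num)).1 (lt_of_le_of_lt ?_ ha)
    rw [h1]
    exact Nat.le_mul_of_pos_right _ (by omega)
  have b1 (j : ℕ) : (a + 1).testBit j = if j < k then false else (2 * q + 1).testBit (j - k) := by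
    rw [h1, Nat.testBit_two_pow_mul_add _ hpos, Nat.zero_testBit]
  have b0 (j : ℕ) : a.testBit j = if j < k then true else (2 * q).testBit (j - k) := by
    rw [h0, Nat.testBit_two_pow_mul_add _ (by omega), Nat.testBit_two_pow_sub_one]
    split_ifs with hj <;> simp [hj]
  refine ⟨⟨k, hk⟩, fun j hj => ?_, ?_, fun j hj => ?_⟩
  · have hj : (j : ℕ) < k := hj
    simp [binRep_eq_testBit, b0, b1, hj]
  · simp [binRep_eq_testBit, b0, b1, Nat.testBit_zero]
  · have hj : k < (j : ℕ) := hj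
    obtain ⟨n, hn⟩ : ∃ n, (j : ℕ) - k = n + 1 := ⟨j - k - 1, by omega⟩
    have h2 : (2 * q + 1) / 2 = q := by omega
    simp [binRep_eq_testBit, b0, b1, hj.not_gt, hn, Nat.testBit_succ, h2]

end Binary

section Construction

variable {r : ℕ}

/-- Input weights testing that bit `k` is the lowest bit with value `-σ` and that the
move register holds `e`. -/
def carryWeight (σ : ℝ) (e : Fin 2 → ℝ) (k : Fin r) : Fin r ⊕ Fin 2 → ℝ :=
  Sum.elim (fun j => if j < k then σ else if j = k then -σ else 0) e

/-- Input weights testing that bit `k` has value `σ`. -/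
def bitWeight (σ : ℝ) (k : Fin r) : Fin r ⊕ Fin 2 → ℝ :=
  Sum.elim (fun j => if j = k then σ else 0) 0

/-- Output weights of the neuron detecting a carry that stops at bit `k`. -/
def carryOut (k t : Fin r) : ℝ := if t = k then 1 else if t < k then -1 else 0

def inWeight (enc : Move → Fin 2 → ℝ) (n : Fin 6) (k : Fin r) : Fin r ⊕ Fin 2 → ℝ :=
  ![bitWeight 1 k, bitWeight (-1) k, carryWeight 1 (enc Move.R) k, carryWeight 1 (enc Move.R) k,
    carryWeight (-1) (enc Move.L) k, carryWeight (-1) (enc Move.L) k] n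

def outWeight (n : Fin 6) (k t : Fin r) : ℝ :=
  ![if t = k then 1 else 0, -(if t = k then 1 else 0), carryOut k t, carryOut k t,
    -carryOut k t, -carryOut k t] n

theorem carryWeight_isTernary {σ : ℝ} (hσ : IsSign σ) {e : Fin 2 → ℝ} (he : ∀ t, IsSign (e t))
    (k : Fin r) (a : Fin r ⊕ Fin 2) : IsTernary (carryWeight σ e k a) := by
  rcases a with j | t
  · exact hσ.isTernary.ite (hσ.isTernary.neg.ite isTernary_zero)
  · exact (he t).isTernary

theorem bitWeight_isTernary {σ : ℝ} (hσ : IsSign σ) (k : Fin r) (a : Fin r ⊕ Fin 2) :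
    IsTernary (bitWeight σ k a) := by
  rcases a with j | t
  · exact hσ.isTernary.ite isTernary_zero
  · exact isTernary_zero

theorem isSign_one : IsSign 1 := Or.inr rfl

theorem isSign_neg_one : IsSign (-1) := Or.inl rfl

theorem carryOut_isTernary (k t : Fin r) : IsTernary (carryOut k t) :=
  isTernary_one.ite (isTernary_one.neg.ite isTernary_zero)

theorem inWeight_isTernary {enc : Move → Fin 2 → ℝ} (henc : ∀ m t, IsSign (enc m t))
    (n : Fin 6) (k : Fin r) (a : Fin r ⊕ Fin 2) : IsTernary (inWeight enc n k a) := by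
  fin_cases n
  · exact bitWeight_isTernary isSign_one k a
  · exact bitWeight_isTernary isSign_neg_one k a
  · exact carryWeight_isTernary isSign_one (henc _) k a
  · exact carryWeight_isTernary isSign_one (henc _) k a
  · exact carryWeight_isTernary isSign_neg_one (henc _) k a
  · exact carryWeight_isTernary isSign_neg_one (henc _) k a

theorem outWeight_isTernary (n : Fin 6) (k t : Fin r) : IsTernary (outWeight n k t) := by
  have h : IsTernary (if t = k then (1 : ℝ) else 0) := isTernary_one.ite isTernary_zero
  fin_cases n
  · exact h
  · exact h.neg
  · exact carryOut_isTernary k t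
  · exact carryOut_isTernary k t
  · exact (carryOut_isTernary k t).neg
  · exact (carryOut_isTernary k t).neg

theorem conjNeuron_bitWeight {σ : ℝ} (hσ : IsSign σ) (k : Fin r) {y : Fin r ⊕ Fin 2 → ℝ}
    (hy : ∀ a, IsSign (y a)) :
    conjNeuron (bitWeight σ k) y 1 = if y (Sum.inl k) = σ then 1 else 0 := by
  split_ifs with h
  · refine conjNeuron_one_of_match (bitWeight_isTernary hσ k) fun a ha => ?_
    rcases a with j | t
    · by_cases hj : j = k
      · subst hj; simp [bitWeight, h]
      · simp [bitWeight, hj] at ha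
    · simp [bitWeight] at ha
  · refine conjNeuron_one_of_mismatch (bitWeight_isTernary hσ k) hy (a := Sum.inl k) ?_ ?_
    · rcases hσ with rfl | rfl <;> simp [bitWeight]
    · simpa [bitWeight] using h

theorem conjNeuron_carryWeight {σ : ℝ} (hσ : IsSign σ) {e : Fin 2 → ℝ} (he : ∀ t, IsSign (e t))
    (k : Fin r) {y : Fin r ⊕ Fin 2 → ℝ} (hy : ∀ a, IsSign (y a))
    [Decidable ((∀ t, y (Sum.inr t) = e t) ∧ (∀ j < k, y (Sum.inl j) = σ) ∧
      y (Sum.inl k) = -σ)] :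
    conjNeuron (carryWeight σ e k) y 1 =
      if (∀ t, y (Sum.inr t) = e t) ∧ (∀ j < k, y (Sum.inl j) = σ) ∧ y (Sum.inl k) = -σ
      then 1 else 0 := by
  have hσ0 : σ ≠ 0 := by rcases hσ with rfl | rfl <;> norm_num
  have ht := carryWeight_isTernary hσ he k
  split_ifs with h
  · obtain ⟨h1, h2, h3⟩ := h
    refine conjNeuron_one_of_match ht fun a ha => ?_
    rcases a with j | t
    · rcases lt_trichotomy j k with hj | hj | hj
      · simp [carryWeight, hj, h2 j hj]
      · subst hj; simp [carryWeight, h3]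
      · simp [carryWeight, hj.not_gt, hj.ne'] at ha
    · exact h1 t
  · rw [not_and_or, not_and_or] at h
    rcases h with h | h | h
    · push Not at h
      obtain ⟨t, h⟩ := h
      refine conjNeuron_one_of_mismatch ht hy (a := Sum.inr t) ?_ h
      rcases he t with h | h <;> simp [carryWeight, h]
    · push Not at h
      obtain ⟨j, hj, h⟩ := h
      exact conjNeuron_one_of_mismatch ht hy (a := Sum.inl j) (by simpa [carryWeight, hj])
        (by simpa [carryWeight, hj])
    · exact conjNeuron_one_of_mismatch ht hy (a := Sum.inl k) (by simpa [carryWeight])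
        (by simpa [carryWeight])

/-- The total contribution of the carry neurons with parameters `σ` and `e` to output bit `t`. -/
noncomputable def carrySum (σ : ℝ) (e : Fin 2 → ℝ) (y : Fin r ⊕ Fin 2 → ℝ) (t : Fin r) : ℝ :=
  ∑ k, carryOut k t * conjNeuron (carryWeight σ e k) y 1

theorem carrySum_of_move_ne {σ : ℝ} (hσ : IsSign σ) {e : Fin 2 → ℝ} (he : ∀ t, IsSign (e t))
    {y : Fin r ⊕ Fin 2 → ℝ} (hy : ∀ a, IsSign (y a)) (h : ¬ ∀ t, y (Sum.inr t) = e t)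
    (t : Fin r) : carrySum σ e y t = 0 := by
  classical
  refine Finset.sum_eq_zero fun k _ => ?_
  rw [conjNeuron_carryWeight hσ he k hy, if_neg fun h' => h h'.1, mul_zero]

theorem carrySum_of_bits_eq {σ : ℝ} (hσ : IsSign σ) {e : Fin 2 → ℝ} (he : ∀ t, IsSign (e t))
    {y : Fin r ⊕ Fin 2 → ℝ} (hy : ∀ a, IsSign (y a)) (h : ∀ j, y (Sum.inl j) = σ)
    (t : Fin r) : carrySum σ e y t = 0 := by
  classical
  refine Finset.sum_eq_zero fun k _ => ?_
  rw [conjNeuron_carryWeight hσ he k hy, if_neg, mul_zero]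
  rintro ⟨-, -, h'⟩
  rw [h] at h'
  rcases hσ with rfl | rfl <;> norm_num at h'

theorem carrySum_of_move_eq {σ : ℝ} (hσ : IsSign σ) {e : Fin 2 → ℝ} (he : ∀ t, IsSign (e t))
    {y : Fin r ⊕ Fin 2 → ℝ} (hy : ∀ a, IsSign (y a)) (h : ∀ t, y (Sum.inr t) = e t)
    {k : Fin r} (hlt : ∀ j < k, y (Sum.inl j) = σ) (hk : y (Sum.inl k) = -σ) (t : Fin r) :
    carrySum σ e y t = carryOut k t := by
  classical
  have hσ' : σ ≠ -σ := by rcases hσ with rfl | rfl <;> norm_num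
  unfold carrySum
  rw [Finset.sum_eq_single k]
  · rw [conjNeuron_carryWeight hσ he k hy, if_pos ⟨h, hlt, hk⟩, mul_one]
  · intro j _ hj
    rw [conjNeuron_carryWeight hσ he j hy, if_neg, mul_zero]
    rintro ⟨-, h1, h2⟩
    rcases lt_or_gt_of_ne hj with hj | hj
    · exact hσ' ((hlt j hj).symm.trans h2)
    · exact hσ' ((h1 k hj).symm.trans hk)
  · simp

theorem sum_outWeight_mul_conjNeuron (enc : Move → Fin 2 → ℝ) {y : Fin r ⊕ Fin 2 → ℝ}
    (hy : ∀ a, IsSign (y a)) (t : Fin r) :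
    ∑ p : Fin 6 × Fin r, outWeight p.1 p.2 t * conjNeuron (inWeight enc p.1 p.2) y 1 =
      y (Sum.inl t) + 2 * carrySum 1 (enc Move.R) y t
        - 2 * carrySum (-1) (enc Move.L) y t := by
  have hp : (if y (Sum.inl t) = 1 then (1 : ℝ) else 0) - (if y (Sum.inl t) = -1 then 1 else 0)
      = y (Sum.inl t) := by
    rcases hy (Sum.inl t) with h | h <;> norm_num [h]
  rw [Fintype.sum_prod_type, Fin.sum_univ_six]
  simp only [outWeight, inWeight, Matrix.cons_val, conjNeuron_bitWeight isSign_one _ hy,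
    conjNeuron_bitWeight isSign_neg_one _ hy, neg_mul, Finset.sum_neg_distrib, ite_mul, one_mul,
    zero_mul, Finset.sum_ite_eq, Finset.mem_univ, if_true]
  simp only [carrySum]
  linear_combination hp

/-- The ternary MLP moving the head position stored in `I1` and writing it to `I2`. -/
noncomputable def headMLP {d : ℕ} (I1 I2 : Fin r → Fin d) (I3 : Fin 2 → Fin d) (F : Fin d)
    (enc : Move → Fin 2 → ℝ) : MLP d (6 * r) where
  W1 h := Function.extend (Sum.elim (Sum.elim I1 I3) fun _ : Fin 1 => F)
    (Sum.elim (inWeight enc (finProdFinEquiv.symm h).1 (finProdFinEquiv.symm h).2) 1) 0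
  b h := -∑ a, |inWeight enc (finProdFinEquiv.symm h).1 (finProdFinEquiv.symm h).2 a|
  W2 i h := Function.extend I2
    (outWeight (finProdFinEquiv.symm h).1 (finProdFinEquiv.symm h).2) 0 i

variable {d : ℕ} {I1 I2 : Fin r → Fin d} {I3 : Fin 2 → Fin d} {F : Fin d}
  {enc : Move → Fin 2 → ℝ}

theorem headMLP_ternary (henc : ∀ m t, IsSign (enc m t)) :
    (headMLP I1 I2 I3 F enc).Ternary := by
  refine ⟨fun h j => IsTernary.extend _ ?_ j, fun i h => IsTernary.extend _ ?_ i⟩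
  · rintro (a | a)
    · exact inWeight_isTernary henc _ _ a
    · exact isTernary_one
  · exact outWeight_isTernary _ _

theorem headMLP_hidden (hJ : Function.Injective (Sum.elim (Sum.elim I1 I3) fun _ : Fin 1 => F))
    (x : Fin d → ℝ) (p : Fin 6 × Fin r) :
    (headMLP I1 I2 I3 F enc).hidden x (finProdFinEquiv p) =
      conjNeuron (inWeight enc p.1 p.2) (fun a => x (Sum.elim I1 I3 a)) (x F) := by
  simp only [MLP.hidden, headMLP, Matrix.mulVec, dotProduct, sum_extend_mul hJ, conjNeuron,
    Equiv.symm_apply_apply, Fintype.sum_sum_type (α₁ := Fin r ⊕ Fin 2)]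
  simp [sub_eq_add_neg]

theorem headMLP_eval_of_notMem (x : Fin d → ℝ) {i : Fin d} (hi : i ∉ Set.range I2) :
    (headMLP I1 I2 I3 F enc).eval x i = 0 := by
  rw [MLP.eval, Matrix.mulVec, dotProduct]
  refine Finset.sum_eq_zero fun h _ => ?_
  simp only [headMLP]
  rw [Function.extend_apply' _ _ _ hi]
  simp

theorem headMLP_eval (hI2 : Function.Injective I2)
    (hJ : Function.Injective (Sum.elim (Sum.elim I1 I3) fun _ : Fin 1 => F))
    (x : Fin d → ℝ) (t : Fin r) :
    (headMLP I1 I2 I3 F enc).eval x (I2 t) =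
      ∑ p : Fin 6 × Fin r, outWeight p.1 p.2 t *
        conjNeuron (inWeight enc p.1 p.2) (fun a => x (Sum.elim I1 I3 a)) (x F) := by
  rw [MLP.eval, Matrix.mulVec, dotProduct, ← finProdFinEquiv.sum_comp]
  refine Finset.sum_congr rfl fun p _ => ?_
  rw [headMLP_hidden hJ]
  simp only [headMLP, hI2.extend_apply, Equiv.symm_apply_apply]

end Construction

/-- Head-movement addition lemma: given an injective encoding
`enc : {L,S,R} → {-1,1}²`, there is a ternary MLP of hidden dimension `6r` which, on
ternary inputs with `x[I₁] = bin_r(s)` for `s ∈ {0,…,2^r−2}` and `x[F] = 1`, writes to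
`I₂` the binary representation of `max(0, s−1)`, `s+1`, or `s`, according to whether
`I₃` encodes `L`, `R`, or `S`; outputs `0` on `I₂` whenever `x[F] = 0`; and always
outputs `0` outside `I₂`. -/
theorem add_head_movement_mlp (d r : ℕ) (I1 I2 : Fin r → Fin d) (I3 : Fin 2 → Fin d)
    (F : Fin d)
    (hdisj : Function.Injective
      (Sum.elim (Sum.elim I1 I2) (Sum.elim I3 (fun _ : Fin 1 => F))))
    (enc : Move → Fin 2 → ℝ) (henc : Function.Injective enc)
    (hencval : ∀ m t, IsSign (enc m t)) :
    ∃ f : MLP d (6 * r), f.Ternary ∧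
      ∀ x : Fin d → ℝ, (∀ i, IsTernary (x i)) →
        (∀ s : ℕ, s + 1 < 2 ^ r → (∀ t, x (I1 t) = binRep r s t) → x F = 1 →
          ((∀ t, x (I3 t) = enc Move.L t) →
            ∀ t, f.eval x (I2 t) = binRep r (s - 1) t) ∧
          ((∀ t, x (I3 t) = enc Move.R t) →
            ∀ t, f.eval x (I2 t) = binRep r (s + 1) t) ∧
          ((∀ t, x (I3 t) = enc Move.S t) →
            ∀ t, f.eval x (I2 t) = binRep r s t)) ∧
        (x F = 0 → ∀ t, f.eval x (I2 t) = 0) ∧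
        (∀ i, i ∉ Set.range I2 → f.eval x i = 0) := by
  have hI2 : Function.Injective I2 := fun a b h => by
    simpa using @hdisj (Sum.inl (Sum.inr a)) (Sum.inl (Sum.inr b)) h
  have hJ : Function.Injective (Sum.elim (Sum.elim I1 I3) fun _ : Fin 1 => F) := by
    have hg : Function.Injective (Sum.elim (Sum.elim (Sum.inl ∘ Sum.inl) (Sum.inr ∘ Sum.inl))
        (Sum.inr ∘ Sum.inr) :
        (Fin r ⊕ Fin 2) ⊕ Fin 1 → (Fin r ⊕ Fin r) ⊕ (Fin 2 ⊕ Fin 1)) := by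
      rintro ((a | a) | a) ((b | b) | b) h <;> simp_all
    convert hdisj.comp hg using 1
    ext ((a | a) | a) <;> rfl
  refine ⟨headMLP I1 I2 I3 F enc, headMLP_ternary hencval, fun x hx => ⟨?_, ?_, ?_⟩⟩
  · intro s hs hbits hF
    have key (m : Move) (hm : ∀ t, x (I3 t) = enc m t) :
        ∃ y : Fin r ⊕ Fin 2 → ℝ, (∀ a, IsSign (y a)) ∧ (∀ j, y (Sum.inl j) = binRep r s j) ∧
          (∀ t, y (Sum.inr t) = enc m t) ∧ ∀ t, (headMLP I1 I2 I3 F enc).eval x (I2 t) =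
            binRep r s t + 2 * carrySum 1 (enc Move.R) y t
              - 2 * carrySum (-1) (enc Move.L) y t := by
      have hy : ∀ a, IsSign (x (Sum.elim I1 I3 a)) := by
        rintro (j | t)
        · simpa [hbits] using binRep_isSign r s j
        · simpa [hm] using hencval m t
      refine ⟨fun a => x (Sum.elim I1 I3 a), hy, hbits, hm, fun t => ?_⟩
      rw [headMLP_eval hI2 hJ, hF, sum_outWeight_mul_conjNeuron enc hy]
      simp [hbits]
    have hne {m m' : Move} (h : m ≠ m') {y : Fin r ⊕ Fin 2 → ℝ}
        (hy : ∀ t, y (Sum.inr t) = enc m t) : ¬ ∀ t, y (Sum.inr t) = enc m' t :=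
      fun h' => h (henc (funext fun t => (hy t).symm.trans (h' t)))
    refine ⟨fun hm t => ?_, fun hm t => ?_, fun hm t => ?_⟩ <;>
      obtain ⟨y, hy, hyb, hym, heval⟩ := key _ hm <;> rw [heval]
    · rw [carrySum_of_move_ne isSign_one (hencval _) hy (hne (by simp) hym)]
      rcases s with _ | s
      · rw [carrySum_of_bits_eq isSign_neg_one (hencval _) hy (by simp [hyb, binRep_zero])]
        simp
      · obtain ⟨k, h1, h2, h3⟩ := exists_binRep_succ r s (by omega)
        rw [carrySum_of_move_eq isSign_neg_one (hencval _) hy hym (k := k)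
          (fun j hj => by rw [hyb, (h1 j hj).2]) (by rw [hyb, h2.2, neg_neg])]
        rcases lt_trichotomy t k with ht | rfl | ht
        · norm_num [carryOut, ht, ht.ne, h1 t ht]
        · norm_num [carryOut, h2]
        · simp [carryOut, ht.not_gt, ht.ne', h3 t ht]
    · rw [carrySum_of_move_ne (σ := -1) isSign_neg_one (hencval _) hy (hne (by simp) hym)]
      obtain ⟨k, h1, h2, h3⟩ := exists_binRep_succ r s hs
      rw [carrySum_of_move_eq isSign_one (hencval _) hy hym (k := k)
        (fun j hj => by rw [hyb, (h1 j hj).1]) (by rw [hyb, h2.1])]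
      rcases lt_trichotomy t k with ht | rfl | ht
      · norm_num [carryOut, ht, ht.ne, h1 t ht]
      · norm_num [carryOut, h2]
      · simp [carryOut, ht.not_gt, ht.ne', h3 t ht]
    · rw [carrySum_of_move_ne isSign_one (hencval _) hy (hne (by simp) hym),
        carrySum_of_move_ne isSign_neg_one (hencval _) hy (hne (by simp) hym)]
      simp
  · intro hF t
    rw [headMLP_eval hI2 hJ, hF]
    exact Finset.sum_eq_zero fun p _ => by
      rw [conjNeuron_zero _ fun a => hx _, mul_zero]
  · exact fun i hi => headMLP_eval_of_notMem x hi
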